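/- The multi-agent modal logic KT_n has the uniform interpolation property: defining A_p(Γ; Δ) := A_p(∅|Γ; Δ) via the G(KT_n⁺) construction, for all finite multisets Γ, Δ and every variable p: (i) V(A_p(Γ; Δ)) ⊆ V(Γ ∪ Δ) \ {p}; (ii) Γ, A_p(Γ; Δ) ⇒ Δ is derivable in G(KT_n); (iii) for all Π, Λ with p ∉ V(Π ∪ Λ), if Π, Γ ⇒ Δ, Λ is derivable in G(KT_n) then Π ⇒ A_p(Γ; Δ), Λ is derivable in G(KT_n). Consequently KT_n has post- and pre-interpolants for any finite set of variables. -/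

import Mathlib

namespace UIP

/-- Multi-agent modal formulas over agent type `α`, with variables, `⊥`,
`∧`, `∨`, `→`, `¬`, and a box `□_i` for each agent `i`. -/
inductive Formula (α : Type) : Type where
  | var : ℕ → Formula α
  | bot : Formula α
  | and : Formula α → Formula α → Formula α
  | or  : Formula α → Formula α → Formula α
  | imp : Formula α → Formula α → Formula α
  | neg : Formula α → Formula α
  | box : α → Formula α → Formula α
  deriving DecidableEq

namespace Formula

variable {α : Type}

/-- The weight of a formula. -/
def weight : Formula α → ℕ
  | var _ => 1
  | bot => 1
  | and A B => weight A + weight B + 1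
  | or A B => weight A + weight B + 1
  | imp A B => weight A + weight B + 1
  | neg A => weight A + 1
  | box _ A => weight A + 1

/-- The set of propositional variables occurring in a formula. -/
def vars : Formula α → Finset ℕ
  | var p => {p}
  | bot => ∅
  | and A B => vars A ∪ vars B
  | or A B => vars A ∪ vars B
  | imp A B => vars A ∪ vars B
  | neg A => vars A
  | box _ A => vars A

/-- A formula is atomic iff it is a propositional variable or `⊥`. -/
def isAtomic : Formula α → Prop
  | var _ => True
  | bot => True
  | _ => False

/-- A formula is outermost-boxed. -/
def isBoxed : Formula α → Prop
  | box _ _ => True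
  | _ => False

/-- A formula is outermost-boxed with a modality different from `□_i`. -/
def isBoxedNe (i : α) : Formula α → Prop
  | box j _ => j ≠ i
  | _ => False

/-- Substitution of the formula `B` for the variable `q`. -/
def subst (q : ℕ) (B : Formula α) : Formula α → Formula α
  | var p => if p = q then B else var p
  | bot => bot
  | and A C => and (subst q B A) (subst q B C)
  | or A C => or (subst q B A) (subst q B C)
  | imp A C => imp (subst q B A) (subst q B C)
  | neg A => neg (subst q B A)
  | box i A => box i (subst q B A)

/-- The set of boxed subformulas of a formula. -/
def boxedSubs [DecidableEq α] : Formula α → Finset (Formula α)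
  | var _ => ∅
  | bot => ∅
  | and A B => boxedSubs A ∪ boxedSubs B
  | or A B => boxedSubs A ∪ boxedSubs B
  | imp A B => boxedSubs A ∪ boxedSubs B
  | neg A => boxedSubs A
  | box i A => insert (box i A) (boxedSubs A)

/-- Boolean evaluation of a formula under a valuation treating variables and
outermost-boxed formulas as atoms (used to define classical tautologies). -/
def evalB (v : Formula α → Bool) : Formula α → Bool
  | var p => v (var p)
  | bot => false
  | and A B => evalB v A && evalB v B
  | or A B => evalB v A || evalB v B
  | imp A B => !evalB v A || evalB v B
  | neg A => !evalB v A
  | box i A => v (box i A)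

end Formula

/-- A classical propositional tautology (boxed formulas treated as atoms). -/
def Tautology {α : Type} (A : Formula α) : Prop :=
  ∀ v : Formula α → Bool, A.evalB v = true

/-- The set of propositional variables occurring in a multiset of formulas. -/
def mVars {α : Type} (Γ : Multiset (Formula α)) : Finset ℕ :=
  (Γ.map Formula.vars).sup

/-- The total weight of a multiset of formulas. -/
def mWt {α : Type} (Γ : Multiset (Formula α)) : ℕ :=
  (Γ.map Formula.weight).sum

/-- The number of boxed subformulas of the set underlying a multiset
(counted without multiplicity). -/
def bCount {α : Type} [DecidableEq α] (Γ : Multiset (Formula α)) : ℕ :=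
  (Γ.toFinset.sup Formula.boxedSubs).card

/-- Hilbert systems `H(K_n)` (`d = t = false`), `H(KD_n)` (`d = true`) and
`H(KT_n)` (`t = true`): all classical tautologies, the K axiom, optionally
seriality `¬□_i ⊥` / reflexivity `□_i A → A`, modus ponens, necessitation. -/
inductive Hil {α : Type} (d t : Bool) : Formula α → Prop
  | taut {A : Formula α} : Tautology A → Hil d t A
  | axK (i : α) (A B : Formula α) :
      Hil d t (((A.imp B).box i).imp ((A.box i).imp (B.box i)))
  | axD (i : α) : d = true → Hil d t ((Formula.bot.box i).neg)
  | axT (i : α) (A : Formula α) : t = true → Hil d t ((A.box i).imp A)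
  | mp {A B : Formula α} : Hil d t (A.imp B) → Hil d t A → Hil d t B
  | nec (i : α) {A : Formula α} : Hil d t A → Hil d t (A.box i)

/-- The sequent calculi `G(K_n)` (`d = t = false`), `G(KD_n)` (`d = true`),
`G(KT_n)` (`t = true`) on sequents of finite multisets. -/
inductive G {α : Type} (d t : Bool) :
    Multiset (Formula α) → Multiset (Formula α) → Prop
  | axId (p : ℕ) (Γ Δ : Multiset (Formula α)) :
      G d t (Formula.var p ::ₘ Γ) (Formula.var p ::ₘ Δ)
  | axBot (Γ Δ : Multiset (Formula α)) : G d t (Formula.bot ::ₘ Γ) Δ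
  | andR {Γ Δ : Multiset (Formula α)} {A B : Formula α} :
      G d t Γ (A ::ₘ Δ) → G d t Γ (B ::ₘ Δ) → G d t Γ (A.and B ::ₘ Δ)
  | andL {Γ Δ : Multiset (Formula α)} {A B : Formula α} :
      G d t (A ::ₘ B ::ₘ Γ) Δ → G d t (A.and B ::ₘ Γ) Δ
  | orR {Γ Δ : Multiset (Formula α)} {A B : Formula α} :
      G d t Γ (A ::ₘ B ::ₘ Δ) → G d t Γ (A.or B ::ₘ Δ)
  | orL {Γ Δ : Multiset (Formula α)} {A B : Formula α} :
      G d t (A ::ₘ Γ) Δ → G d t (B ::ₘ Γ) Δ → G d t (A.or B ::ₘ Γ) Δ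
  | impR {Γ Δ : Multiset (Formula α)} {A B : Formula α} :
      G d t (A ::ₘ Γ) (B ::ₘ Δ) → G d t Γ (A.imp B ::ₘ Δ)
  | impL {Γ Δ : Multiset (Formula α)} {A B : Formula α} :
      G d t Γ (A ::ₘ Δ) → G d t (B ::ₘ Γ) Δ → G d t (A.imp B ::ₘ Γ) Δ
  | negR {Γ Δ : Multiset (Formula α)} {A : Formula α} :
      G d t (A ::ₘ Γ) Δ → G d t Γ (A.neg ::ₘ Δ)
  | negL {Γ Δ : Multiset (Formula α)} {A : Formula α} :
      G d t Γ (A ::ₘ Δ) → G d t (A.neg ::ₘ Γ) Δ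
  | boxK (i : α) {Γ : Multiset (Formula α)} {A : Formula α}
      (Sg Ω : Multiset (Formula α)) :
      (∀ C ∈ Sg, C.isAtomic ∨ C.isBoxedNe i) →
      (∀ C ∈ Ω, C.isAtomic ∨ C.isBoxed) →
      G d t Γ {A} →
      G d t (Sg + Γ.map (Formula.box i)) (Formula.box i A ::ₘ Ω)
  | boxD (i : α) {Γ : Multiset (Formula α)} (Sg Ω : Multiset (Formula α)) :
      d = true → Γ ≠ 0 →
      (∀ C ∈ Sg, C.isAtomic ∨ C.isBoxedNe i) →
      (∀ C ∈ Ω, C.isAtomic ∨ C.isBoxed) →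
      G d t Γ 0 →
      G d t (Sg + Γ.map (Formula.box i)) Ω
  | boxT (i : α) {Γ Δ : Multiset (Formula α)} {A : Formula α} :
      t = true →
      G d t (Formula.box i A ::ₘ A ::ₘ Γ) Δ →
      G d t (Formula.box i A ::ₘ Γ) Δ

/-- Height-indexed version of `G(K_n)`: `GH n Γ Δ` means `Γ ⇒ Δ` has a
derivation of height at most `n` (initial sequents at every height,
each rule adds one to the height). -/
inductive GH {α : Type} : ℕ → Multiset (Formula α) → Multiset (Formula α) → Prop
  | axId (n : ℕ) (p : ℕ) (Γ Δ : Multiset (Formula α)) :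
      GH n (Formula.var p ::ₘ Γ) (Formula.var p ::ₘ Δ)
  | axBot (n : ℕ) (Γ Δ : Multiset (Formula α)) : GH n (Formula.bot ::ₘ Γ) Δ
  | andR {n : ℕ} {Γ Δ : Multiset (Formula α)} {A B : Formula α} :
      GH n Γ (A ::ₘ Δ) → GH n Γ (B ::ₘ Δ) → GH (n + 1) Γ (A.and B ::ₘ Δ)
  | andL {n : ℕ} {Γ Δ : Multiset (Formula α)} {A B : Formula α} :
      GH n (A ::ₘ B ::ₘ Γ) Δ → GH (n + 1) (A.and B ::ₘ Γ) Δ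
  | orR {n : ℕ} {Γ Δ : Multiset (Formula α)} {A B : Formula α} :
      GH n Γ (A ::ₘ B ::ₘ Δ) → GH (n + 1) Γ (A.or B ::ₘ Δ)
  | orL {n : ℕ} {Γ Δ : Multiset (Formula α)} {A B : Formula α} :
      GH n (A ::ₘ Γ) Δ → GH n (B ::ₘ Γ) Δ → GH (n + 1) (A.or B ::ₘ Γ) Δ
  | impR {n : ℕ} {Γ Δ : Multiset (Formula α)} {A B : Formula α} :
      GH n (A ::ₘ Γ) (B ::ₘ Δ) → GH (n + 1) Γ (A.imp B ::ₘ Δ)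
  | impL {n : ℕ} {Γ Δ : Multiset (Formula α)} {A B : Formula α} :
      GH n Γ (A ::ₘ Δ) → GH n (B ::ₘ Γ) Δ → GH (n + 1) (A.imp B ::ₘ Γ) Δ
  | negR {n : ℕ} {Γ Δ : Multiset (Formula α)} {A : Formula α} :
      GH n (A ::ₘ Γ) Δ → GH (n + 1) Γ (A.neg ::ₘ Δ)
  | negL {n : ℕ} {Γ Δ : Multiset (Formula α)} {A : Formula α} :
      GH n Γ (A ::ₘ Δ) → GH (n + 1) (A.neg ::ₘ Γ) Δ
  | boxK {n : ℕ} (i : α) {Γ : Multiset (Formula α)} {A : Formula α}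
      (Sg Ω : Multiset (Formula α)) :
      (∀ C ∈ Sg, C.isAtomic ∨ C.isBoxedNe i) →
      (∀ C ∈ Ω, C.isAtomic ∨ C.isBoxed) →
      GH n Γ {A} →
      GH (n + 1) (Sg + Γ.map (Formula.box i)) (Formula.box i A ::ₘ Ω)

/-- The premise-of relation for backward proof-search in `G(K_n)`:
`GKPrem S S'` holds iff `S` is a premise of a rule instance of `G(K_n)`
with conclusion `S'`. -/
inductive GKPrem {α : Type} :
    Multiset (Formula α) × Multiset (Formula α) →
    Multiset (Formula α) × Multiset (Formula α) → Prop
  | andR1 (Γ Δ : Multiset (Formula α)) (A B : Formula α) :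
      GKPrem (Γ, A ::ₘ Δ) (Γ, A.and B ::ₘ Δ)
  | andR2 (Γ Δ : Multiset (Formula α)) (A B : Formula α) :
      GKPrem (Γ, B ::ₘ Δ) (Γ, A.and B ::ₘ Δ)
  | andL (Γ Δ : Multiset (Formula α)) (A B : Formula α) :
      GKPrem (A ::ₘ B ::ₘ Γ, Δ) (A.and B ::ₘ Γ, Δ)
  | orR (Γ Δ : Multiset (Formula α)) (A B : Formula α) :
      GKPrem (Γ, A ::ₘ B ::ₘ Δ) (Γ, A.or B ::ₘ Δ)
  | orL1 (Γ Δ : Multiset (Formula α)) (A B : Formula α) :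
      GKPrem (A ::ₘ Γ, Δ) (A.or B ::ₘ Γ, Δ)
  | orL2 (Γ Δ : Multiset (Formula α)) (A B : Formula α) :
      GKPrem (B ::ₘ Γ, Δ) (A.or B ::ₘ Γ, Δ)
  | impR (Γ Δ : Multiset (Formula α)) (A B : Formula α) :
      GKPrem (A ::ₘ Γ, B ::ₘ Δ) (Γ, A.imp B ::ₘ Δ)
  | impL1 (Γ Δ : Multiset (Formula α)) (A B : Formula α) :
      GKPrem (Γ, A ::ₘ Δ) (A.imp B ::ₘ Γ, Δ)
  | impL2 (Γ Δ : Multiset (Formula α)) (A B : Formula α) :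
      GKPrem (B ::ₘ Γ, Δ) (A.imp B ::ₘ Γ, Δ)
  | negR (Γ Δ : Multiset (Formula α)) (A : Formula α) :
      GKPrem (A ::ₘ Γ, Δ) (Γ, A.neg ::ₘ Δ)
  | negL (Γ Δ : Multiset (Formula α)) (A : Formula α) :
      GKPrem (Γ, A ::ₘ Δ) (A.neg ::ₘ Γ, Δ)
  | boxK (i : α) (Γ : Multiset (Formula α)) (A : Formula α)
      (Sg Ω : Multiset (Formula α)) :
      (∀ C ∈ Sg, C.isAtomic ∨ C.isBoxedNe i) →
      (∀ C ∈ Ω, C.isAtomic ∨ C.isBoxed) →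
      GKPrem (Γ, {A}) (Sg + Γ.map (Formula.box i), Formula.box i A ::ₘ Ω)

/-- The sequent calculus `G(KT_n⁺)` on T-sequents `Σ | Γ ⇒ Δ`. -/
inductive GT {α : Type} :
    Multiset (Formula α) → Multiset (Formula α) → Multiset (Formula α) → Prop
  | axId (Sg : Multiset (Formula α)) (p : ℕ) (Γ Δ : Multiset (Formula α)) :
      GT Sg (Formula.var p ::ₘ Γ) (Formula.var p ::ₘ Δ)
  | axBot (Sg Γ Δ : Multiset (Formula α)) : GT Sg (Formula.bot ::ₘ Γ) Δ
  | andR {Sg Γ Δ : Multiset (Formula α)} {A B : Formula α} :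
      GT Sg Γ (A ::ₘ Δ) → GT Sg Γ (B ::ₘ Δ) → GT Sg Γ (A.and B ::ₘ Δ)
  | andL {Sg Γ Δ : Multiset (Formula α)} {A B : Formula α} :
      GT Sg (A ::ₘ B ::ₘ Γ) Δ → GT Sg (A.and B ::ₘ Γ) Δ
  | orR {Sg Γ Δ : Multiset (Formula α)} {A B : Formula α} :
      GT Sg Γ (A ::ₘ B ::ₘ Δ) → GT Sg Γ (A.or B ::ₘ Δ)
  | orL {Sg Γ Δ : Multiset (Formula α)} {A B : Formula α} :
      GT Sg (A ::ₘ Γ) Δ → GT Sg (B ::ₘ Γ) Δ → GT Sg (A.or B ::ₘ Γ) Δ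
  | impR {Sg Γ Δ : Multiset (Formula α)} {A B : Formula α} :
      GT Sg (A ::ₘ Γ) (B ::ₘ Δ) → GT Sg Γ (A.imp B ::ₘ Δ)
  | impL {Sg Γ Δ : Multiset (Formula α)} {A B : Formula α} :
      GT Sg Γ (A ::ₘ Δ) → GT Sg (B ::ₘ Γ) Δ → GT Sg (A.imp B ::ₘ Γ) Δ
  | negR {Sg Γ Δ : Multiset (Formula α)} {A : Formula α} :
      GT Sg (A ::ₘ Γ) Δ → GT Sg Γ (A.neg ::ₘ Δ)
  | negL {Sg Γ Δ : Multiset (Formula α)} {A : Formula α} :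
      GT Sg Γ (A ::ₘ Δ) → GT Sg (A.neg ::ₘ Γ) Δ
  | boxK (i : α) {Γ : Multiset (Formula α)} {A : Formula α}
      (Sg Pis Ω : Multiset (Formula α)) :
      (∀ C ∈ Sg, C.isBoxedNe i) →
      (∀ C ∈ Pis, C.isAtomic) →
      (∀ C ∈ Ω, C.isAtomic ∨ C.isBoxed) →
      GT 0 Γ {A} →
      GT (Sg + Γ.map (Formula.box i)) Pis (Formula.box i A ::ₘ Ω)
  | boxT (i : α) {Sg Γ Δ : Multiset (Formula α)} {A : Formula α} :
      GT (Formula.box i A ::ₘ Sg) (A ::ₘ Γ) Δ →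
      GT Sg (Formula.box i A ::ₘ Γ) Δ

/-- The premise-of relation for backward proof-search in `G(KT_n⁺)`. -/
inductive TPrem {α : Type} :
    Multiset (Formula α) × Multiset (Formula α) × Multiset (Formula α) →
    Multiset (Formula α) × Multiset (Formula α) × Multiset (Formula α) → Prop
  | andR1 (Sg Γ Δ : Multiset (Formula α)) (A B : Formula α) :
      TPrem (Sg, Γ, A ::ₘ Δ) (Sg, Γ, A.and B ::ₘ Δ)
  | andR2 (Sg Γ Δ : Multiset (Formula α)) (A B : Formula α) :
      TPrem (Sg, Γ, B ::ₘ Δ) (Sg, Γ, A.and B ::ₘ Δ)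
  | andL (Sg Γ Δ : Multiset (Formula α)) (A B : Formula α) :
      TPrem (Sg, A ::ₘ B ::ₘ Γ, Δ) (Sg, A.and B ::ₘ Γ, Δ)
  | orR (Sg Γ Δ : Multiset (Formula α)) (A B : Formula α) :
      TPrem (Sg, Γ, A ::ₘ B ::ₘ Δ) (Sg, Γ, A.or B ::ₘ Δ)
  | orL1 (Sg Γ Δ : Multiset (Formula α)) (A B : Formula α) :
      TPrem (Sg, A ::ₘ Γ, Δ) (Sg, A.or B ::ₘ Γ, Δ)
  | orL2 (Sg Γ Δ : Multiset (Formula α)) (A B : Formula α) :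
      TPrem (Sg, B ::ₘ Γ, Δ) (Sg, A.or B ::ₘ Γ, Δ)
  | impR (Sg Γ Δ : Multiset (Formula α)) (A B : Formula α) :
      TPrem (Sg, A ::ₘ Γ, B ::ₘ Δ) (Sg, Γ, A.imp B ::ₘ Δ)
  | impL1 (Sg Γ Δ : Multiset (Formula α)) (A B : Formula α) :
      TPrem (Sg, Γ, A ::ₘ Δ) (Sg, A.imp B ::ₘ Γ, Δ)
  | impL2 (Sg Γ Δ : Multiset (Formula α)) (A B : Formula α) :
      TPrem (Sg, B ::ₘ Γ, Δ) (Sg, A.imp B ::ₘ Γ, Δ)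
  | negR (Sg Γ Δ : Multiset (Formula α)) (A : Formula α) :
      TPrem (Sg, A ::ₘ Γ, Δ) (Sg, Γ, A.neg ::ₘ Δ)
  | negL (Sg Γ Δ : Multiset (Formula α)) (A : Formula α) :
      TPrem (Sg, Γ, A ::ₘ Δ) (Sg, A.neg ::ₘ Γ, Δ)
  | boxK (i : α) (Γ : Multiset (Formula α)) (A : Formula α)
      (Sg Pis Ω : Multiset (Formula α)) :
      (∀ C ∈ Sg, C.isBoxedNe i) →
      (∀ C ∈ Pis, C.isAtomic) →
      (∀ C ∈ Ω, C.isAtomic ∨ C.isBoxed) →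
      TPrem (0, Γ, {A}) (Sg + Γ.map (Formula.box i), Pis, Formula.box i A ::ₘ Ω)
  | boxT (i : α) (Sg Γ Δ : Multiset (Formula α)) (A : Formula α) :
      TPrem (Formula.box i A ::ₘ Sg, A ::ₘ Γ, Δ) (Sg, Formula.box i A ::ₘ Γ, Δ)

/-- The termination measure `⟨b(Σ,Γ,Δ), wt(Γ,Δ)⟩` on T-sequents. -/
def tMeasure {α : Type} [DecidableEq α]
    (s : Multiset (Formula α) × Multiset (Formula α) × Multiset (Formula α)) :
    ℕ × ℕ :=
  (bCount (s.1 + s.2.1 + s.2.2), mWt s.2.1 + mWt s.2.2)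

end UIP

open UIP Formula

namespace UIP

variable {α : Type}

/-- Reflexive multi-agent Kripke models. -/
structure ReflModel (α : Type) : Type 1 where
  World : Type
  rel : α → World → World → Prop
  val : World → ℕ → Prop
  rel_self : ∀ i w, rel i w w

/-- Truth of a formula at a world of a model. -/
def Sat (M : ReflModel α) : Formula α → M.World → Prop
  | .var p, w => M.val w p
  | .bot, _ => False
  | .and A B, w => Sat M A w ∧ Sat M B w
  | .or A B, w => Sat M A w ∨ Sat M B w
  | .imp A B, w => Sat M A w → Sat M B w
  | .neg A, w => ¬ Sat M A w
  | .box i A, w => ∀ v, M.rel i w v → Sat M A v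

/-- A sequent is valid if it holds at every world of every reflexive model. -/
def Valid (Γ Δ : Multiset (Formula α)) : Prop :=
  ∀ (M : ReflModel α) (w : M.World), (∀ A ∈ Γ, Sat M A w) → ∃ B ∈ Δ, Sat M B w

/-- Modal depth. -/
def modalDepth : Formula α → ℕ
  | .var _ => 0
  | .bot => 0
  | .and A B => max (modalDepth A) (modalDepth B)
  | .or A B => max (modalDepth A) (modalDepth B)
  | .imp A B => max (modalDepth A) (modalDepth B)
  | .neg A => modalDepth A
  | .box _ A => modalDepth A + 1

theorem mem_mVars {Γ : Multiset (Formula α)} {q : ℕ} :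
    q ∈ mVars Γ ↔ ∃ A ∈ Γ, q ∈ A.vars := by
  induction Γ using Multiset.induction_on with
  | empty => simp [mVars]
  | cons A Γ ih =>
    simp only [mVars, Multiset.map_cons, Multiset.sup_cons, Finset.sup_eq_union,
      Finset.mem_union, Multiset.mem_cons, exists_eq_or_imp] at ih ⊢
    rw [ih]

/-! ### Soundness -/

theorem G.valid {Γ Δ : Multiset (Formula α)} (h : G false true Γ Δ) : Valid Γ Δ := by
  induction h with
  | axId p Γ Δ => exact fun M w h => ⟨var p, by simp, h _ (by simp)⟩
  | axBot Γ Δ => exact fun M w h => (h bot (by simp)).elim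
  | boxK i Sg Ω _ _ _ ih =>
    intro M w h
    refine ⟨_, Multiset.mem_cons_self _ _, fun v hv => ?_⟩
    obtain ⟨B, hB, hs⟩ := ih M v fun C hC =>
      h (box i C) (Multiset.mem_add.2 (.inr (Multiset.mem_map_of_mem _ hC))) v hv
    rwa [Multiset.mem_singleton.1 hB] at hs
  | boxD _ _ _ hd => cases hd
  | boxT i _ _ ih =>
    intro M w h
    refine ih M w ?_
    simp only [Multiset.mem_cons, forall_eq_or_imp] at h ⊢
    exact ⟨h.1, h.1 w (M.rel_self i w), h.2⟩
  | _ =>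
    intro M w h
    simp only [Valid, Multiset.mem_cons, forall_eq_or_imp, exists_eq_or_imp, Sat] at *
    grind

/-! ### Completeness -/

section Glue

variable {ι : Type} (agent : ι → α) (M : ι → ReflModel α) (root : ∀ k, (M k).World)

/-- Accessibility in the model that adds a root below a family of pointed models. -/
inductive GlueRel : α → Option (Σ k, (M k).World) → Option (Σ k, (M k).World) → Prop
  | refl_root (i : α) : GlueRel i none none
  | to_root (k : ι) : GlueRel (agent k) none (some ⟨k, root k⟩)
  | inner (k : ι) (i : α) (w v : (M k).World) :
      (M k).rel i w v → GlueRel i (some ⟨k, w⟩) (some ⟨k, v⟩)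

/-- The model obtained by adding a root below a family of pointed models; the root of the
`k`-th model is accessible from the new root for the agent `agent k`. -/
def glue (rootVal : ℕ → Prop) : ReflModel α where
  World := Option (Σ k, (M k).World)
  rel := GlueRel agent M root
  val
    | none => rootVal
    | some ⟨k, w⟩ => (M k).val w
  rel_self
    | i, none => .refl_root i
    | i, some ⟨k, w⟩ => .inner k i w w ((M k).rel_self i w)

theorem glue_rel_root (rootVal : ℕ → Prop) (k : ι) :
    (glue agent M root rootVal).rel (agent k) none (some ⟨k, root k⟩) :=
  .to_root k

theorem sat_glue_some (rootVal : ℕ → Prop) (A : Formula α) (k : ι) (w : (M k).World) :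
    Sat (glue agent M root rootVal) A (some ⟨k, w⟩) ↔ Sat (M k) A w := by
  induction A generalizing w with
  | var p => rfl
  | bot => rfl
  | box i A ih =>
    refine ⟨fun h v hv => (ih v).1 (h _ (.inner k i w v hv)), fun h v hv => ?_⟩
    cases hv with
    | inner _ _ _ v hv => exact (ih v).2 (h v hv)
  | _ => simp_all only [Sat]

end Glue

/-- A pointed model refuting the T-sequent `Sg | Γ ⇒ Δ`: boxed formulas in `Sg` are only
required to hold with respect to the proper successors of the point. -/
def Refutable (Sg Γ Δ : Multiset (Formula α)) : Prop :=
  ∃ (M : ReflModel α) (w : M.World),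
    (∀ i C, box i C ∈ Sg → ∀ v, M.rel i w v → v ≠ w → Sat M C v) ∧
    (∀ C ∈ Γ, Sat M C w) ∧ ∀ C ∈ Δ, ¬ Sat M C w

theorem exists_unbox (i : α) (Sg : Multiset (Formula α)) (h : ∀ C ∈ Sg, C.isBoxed) :
    ∃ Rest Th : Multiset (Formula α),
      Sg = Rest + Th.map (box i) ∧ ∀ C ∈ Rest, C.isBoxedNe i := by
  induction Sg using Multiset.induction_on with
  | empty => exact ⟨0, 0, by simp⟩
  | cons A Sg ih =>
    obtain ⟨Rest, Th, rfl, hR⟩ := ih fun C hC => h C (Multiset.mem_cons_of_mem hC)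
    have hA := h A (Multiset.mem_cons_self _ _)
    cases A with
    | box j A =>
      by_cases hj : j = i
      · subst hj
        exact ⟨Rest, A ::ₘ Th, by simp, hR⟩
      · refine ⟨box j A ::ₘ Rest, Th, by simp, ?_⟩
        simpa using ⟨hj, hR⟩
    | _ => exact hA.elim

theorem refutable_of_irreducible {d : ℕ} {Sg Γ Δ : Multiset (Formula α)}
    (ih : ∀ Γ Δ : Multiset (Formula α), (∀ C ∈ Γ + Δ, modalDepth C < d) →
      ¬ G false true Γ Δ → Refutable 0 Γ Δ)
    (hSg : ∀ C ∈ Sg, C.isBoxed) (hΓ : ∀ C ∈ Γ, C.isAtomic)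
    (hΔ : ∀ C ∈ Δ, C.isAtomic ∨ C.isBoxed)
    (hd : ∀ C ∈ Sg + Γ + Δ, modalDepth C ≤ d) (hG : ¬ G false true (Sg + Γ) Δ) :
    Refutable Sg Γ Δ := by
  have key : ∀ x : {x : α × Formula α // box x.1 x.2 ∈ Δ},
      ∃ (M : ReflModel α) (w : M.World),
        (∀ C, box x.1.1 C ∈ Sg → Sat M C w) ∧ ¬ Sat M x.1.2 w := by
    rintro ⟨⟨i, A⟩, hA⟩
    obtain ⟨Ω, rfl⟩ := Multiset.exists_cons_of_mem hA
    obtain ⟨Rest, Th, rfl, hR⟩ := exists_unbox i Sg hSg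
    have hn : ¬ G false true Th {A} := fun hT => by
      refine hG ?_
      rw [add_right_comm]
      refine G.boxK i _ _ ?_ (fun C hC => hΔ C (Multiset.mem_cons_of_mem hC)) hT
      intro C hC
      rcases Multiset.mem_add.1 hC with hC | hC
      · exact .inr (hR C hC)
      · exact .inl (hΓ C hC)
    obtain ⟨M, w, -, h1, h2⟩ := ih Th {A} (by
      intro C hC
      have : modalDepth (box i C) ≤ d := by
        apply hd
        rcases Multiset.mem_add.1 hC with hC | hC
        · simp [hC]
        · simp [Multiset.mem_singleton.1 hC]
      exact this) hn
    refine ⟨M, w, fun C hC => ?_, h2 A (by simp)⟩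
    rcases Multiset.mem_add.1 hC with hC | hC
    · exact (hR _ hC rfl).elim
    · obtain ⟨D, hD, hDC⟩ := Multiset.mem_map.1 hC
      cases hDC
      exact h1 _ hD
  choose M root h1 h2 using key
  refine ⟨glue (fun x => x.1.1) M root (fun q => var q ∈ Γ), none, ?_, ?_, ?_⟩
  · intro i C hC v hv hne
    cases hv with
    | refl_root => exact (hne rfl).elim
    | to_root k => exact (sat_glue_some ..).2 (h1 k C hC)
  · intro C hC
    have hCa := hΓ C hC
    cases C with
    | var q => exact hC
    | bot =>
      obtain ⟨Γ', rfl⟩ := Multiset.exists_cons_of_mem hC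
      exact (hG (by rw [Multiset.add_cons]; exact .axBot _ _)).elim
    | _ => exact hCa.elim
  · intro C hC hs
    have hCa := hΔ C hC
    cases C with
    | var q =>
      obtain ⟨Γ', rfl⟩ := Multiset.exists_cons_of_mem (show var q ∈ Γ from hs)
      obtain ⟨Δ', rfl⟩ := Multiset.exists_cons_of_mem hC
      exact hG (by rw [Multiset.add_cons]; exact .axId q _ _)
    | bot => exact hs
    | box i A =>
      exact h2 ⟨(i, A), hC⟩ ((sat_glue_some ..).1
        (hs _ (glue_rel_root (fun x => x.1.1) M root _ ⟨(i, A), hC⟩)))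
    | _ => simp [isAtomic, isBoxed] at hCa

theorem refutable_of_not_derivable_aux {d : ℕ}
    (ih : ∀ Γ Δ : Multiset (Formula α), (∀ C ∈ Γ + Δ, modalDepth C < d) →
      ¬ G false true Γ Δ → Refutable 0 Γ Δ) (n : ℕ) :
    ∀ Sg Γ Δ : Multiset (Formula α), mWt Γ + mWt Δ < n → (∀ C ∈ Sg, C.isBoxed) →
      (∀ C ∈ Sg + Γ + Δ, modalDepth C ≤ d) → ¬ G false true (Sg + Γ) Δ →
      Refutable Sg Γ Δ := by
  induction n with
  | zero => intro _ _ _ h; omega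
  | succ n ihn =>
    intro Sg Γ Δ hn hSg hd hG
    by_cases hΓ : ∀ C ∈ Γ, C.isAtomic
    · by_cases hΔ : ∀ C ∈ Δ, C.isAtomic ∨ C.isBoxed
      · exact refutable_of_irreducible ih hSg hΓ hΔ hd hG
      push Not at hΔ
      obtain ⟨C, hC, hCa, hCb⟩ := hΔ
      obtain ⟨Δ, rfl⟩ := Multiset.exists_cons_of_mem hC
      cases C with
      | var _ => exact (hCa trivial).elim
      | bot => exact (hCa trivial).elim
      | box _ _ => exact (hCb trivial).elim
      | and A B =>
        rcases not_and_or.1 fun h => hG (.andR h.1 h.2) with h | h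
        · obtain ⟨M, w, h1, h2, h3⟩ := ihn Sg Γ (A ::ₘ Δ)
            (by simp [mWt, weight] at hn ⊢; omega) hSg
            (by simp [modalDepth] at hd ⊢; grind) h
          exact ⟨M, w, h1, h2, by simp [Sat] at h3 ⊢; grind⟩
        · obtain ⟨M, w, h1, h2, h3⟩ := ihn Sg Γ (B ::ₘ Δ)
            (by simp [mWt, weight] at hn ⊢; omega) hSg
            (by simp [modalDepth] at hd ⊢; grind) h
          exact ⟨M, w, h1, h2, by simp [Sat] at h3 ⊢; grind⟩
      | or A B =>
        obtain ⟨M, w, h1, h2, h3⟩ := ihn Sg Γ (A ::ₘ B ::ₘ Δ)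
          (by simp [mWt, weight] at hn ⊢; omega) hSg
          (by simp [modalDepth] at hd ⊢; grind) fun h => hG (.orR h)
        exact ⟨M, w, h1, h2, by simp [Sat] at h3 ⊢; grind⟩
      | imp A B =>
        obtain ⟨M, w, h1, h2, h3⟩ := ihn Sg (A ::ₘ Γ) (B ::ₘ Δ)
          (by simp [mWt, weight] at hn ⊢; omega) hSg
          (by simp [modalDepth] at hd ⊢; grind)
          fun h => hG (.impR (by rwa [Multiset.add_cons] at h))
        exact ⟨M, w, h1, by simp at h2; exact h2.2, by simp [Sat] at h2 h3 ⊢; grind⟩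
      | neg A =>
        obtain ⟨M, w, h1, h2, h3⟩ := ihn Sg (A ::ₘ Γ) Δ
          (by simp [mWt, weight] at hn ⊢; omega) hSg
          (by simp [modalDepth] at hd ⊢; grind)
          fun h => hG (.negR (by rwa [Multiset.add_cons] at h))
        exact ⟨M, w, h1, by simp at h2; exact h2.2, by simp [Sat] at h2 h3 ⊢; grind⟩
    · push Not at hΓ
      obtain ⟨C, hC, hCa⟩ := hΓ
      obtain ⟨Γ, rfl⟩ := Multiset.exists_cons_of_mem hC
      rw [Multiset.add_cons] at hG
      cases C with
      | var _ => exact (hCa trivial).elim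
      | bot => exact (hCa trivial).elim
      | and A B =>
        obtain ⟨M, w, h1, h2, h3⟩ := ihn Sg (A ::ₘ B ::ₘ Γ) Δ
          (by simp [mWt, weight] at hn ⊢; omega) hSg
          (by simp [modalDepth] at hd ⊢; grind)
          fun h => hG (.andL (by rwa [Multiset.add_cons, Multiset.add_cons] at h))
        exact ⟨M, w, h1, by simp [Sat] at h2 ⊢; grind, h3⟩
      | or A B =>
        rcases not_and_or.1 fun h => hG (.orL h.1 h.2) with h | h
        · obtain ⟨M, w, h1, h2, h3⟩ := ihn Sg (A ::ₘ Γ) Δ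
            (by simp [mWt, weight] at hn ⊢; omega) hSg
            (by simp [modalDepth] at hd ⊢; grind) (by rwa [Multiset.add_cons])
          exact ⟨M, w, h1, by simp [Sat] at h2 ⊢; grind, h3⟩
        · obtain ⟨M, w, h1, h2, h3⟩ := ihn Sg (B ::ₘ Γ) Δ
            (by simp [mWt, weight] at hn ⊢; omega) hSg
            (by simp [modalDepth] at hd ⊢; grind) (by rwa [Multiset.add_cons])
          exact ⟨M, w, h1, by simp [Sat] at h2 ⊢; grind, h3⟩
      | imp A B =>
        rcases not_and_or.1 fun h => hG (.impL h.1 h.2) with h | h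
        · obtain ⟨M, w, h1, h2, h3⟩ := ihn Sg Γ (A ::ₘ Δ)
            (by simp [mWt, weight] at hn ⊢; omega) hSg
            (by simp [modalDepth] at hd ⊢; grind) h
          exact ⟨M, w, h1, by simp [Sat] at h2 h3 ⊢; grind,
            by simp at h3; exact h3.2⟩
        · obtain ⟨M, w, h1, h2, h3⟩ := ihn Sg (B ::ₘ Γ) Δ
            (by simp [mWt, weight] at hn ⊢; omega) hSg
            (by simp [modalDepth] at hd ⊢; grind) (by rwa [Multiset.add_cons])
          exact ⟨M, w, h1, by simp [Sat] at h2 ⊢; grind, h3⟩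
      | neg A =>
        obtain ⟨M, w, h1, h2, h3⟩ := ihn Sg Γ (A ::ₘ Δ)
          (by simp [mWt, weight] at hn ⊢; omega) hSg
          (by simp [modalDepth] at hd ⊢; grind) fun h => hG (.negL h)
        exact ⟨M, w, h1, by simp [Sat] at h2 h3 ⊢; grind, by simp at h3; exact h3.2⟩
      | box i A =>
        obtain ⟨M, w, h1, h2, h3⟩ := ihn (box i A ::ₘ Sg) (A ::ₘ Γ) Δ
          (by simp [mWt, weight] at hn ⊢; omega)
          (by simpa using ⟨trivial, hSg⟩)
          (by simp [modalDepth] at hd ⊢; grind)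
          fun h => hG (.boxT i rfl (by rwa [Multiset.add_cons, Multiset.cons_add,
            Multiset.cons_swap] at h))
        refine ⟨M, w, fun j C hC => h1 j C (Multiset.mem_cons_of_mem hC), ?_, h3⟩
        simp only [Multiset.mem_cons, forall_eq_or_imp] at h2 ⊢
        refine ⟨fun v hv => ?_, h2.2⟩
        by_cases hvw : v = w
        · exact hvw ▸ h2.1
        · exact h1 i A (Multiset.mem_cons_self _ _) v hv hvw

theorem exists_modalDepth_lt (Γ : Multiset (Formula α)) :
    ∃ d, ∀ C ∈ Γ, modalDepth C < d :=
  ⟨(Γ.map modalDepth).sup + 1, fun _ hC =>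
    Nat.lt_succ_of_le (Multiset.le_sup (Multiset.mem_map_of_mem _ hC))⟩

theorem refutable_of_not_derivable (d : ℕ) :
    ∀ Γ Δ : Multiset (Formula α), (∀ C ∈ Γ + Δ, modalDepth C < d) →
      ¬ G false true Γ Δ → Refutable 0 Γ Δ := by
  induction d with
  | zero =>
    intro Γ Δ hd _
    exact ⟨⟨Unit, fun _ _ _ => True, fun _ _ => True, fun _ _ => trivial⟩, (), by simp,
      fun C hC => absurd (hd C (Multiset.mem_add.2 (.inl hC))) (Nat.not_lt_zero _),
      fun C hC => absurd (hd C (Multiset.mem_add.2 (.inr hC))) (Nat.not_lt_zero _)⟩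
  | succ d ih =>
    intro Γ Δ hd hG
    exact refutable_of_not_derivable_aux ih _ 0 Γ Δ (Nat.lt_succ_self _) (by simp)
      (fun C hC => Nat.le_of_lt_succ (hd C (by simpa using hC))) (by simpa using hG)

theorem derivable_iff_valid {Γ Δ : Multiset (Formula α)} :
    G false true Γ Δ ↔ Valid Γ Δ := by
  refine ⟨G.valid, fun h => ?_⟩
  by_contra hG
  obtain ⟨d, hd⟩ := exists_modalDepth_lt (Γ + Δ)
  obtain ⟨M, w, -, h1, h2⟩ := refutable_of_not_derivable d Γ Δ hd hG
  obtain ⟨B, hB, hs⟩ := h M w h1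
  exact h2 B hB hs

/-! ### Finite descriptions of worlds -/

/-- Conjunction of a list of formulas. -/
def bigAnd : List (Formula α) → Formula α
  | [] => neg bot
  | A :: l => A.and (bigAnd l)

/-- Disjunction of a list of formulas. -/
def bigOr : List (Formula α) → Formula α
  | [] => bot
  | A :: l => A.or (bigOr l)

theorem sat_bigAnd (M : ReflModel α) (l : List (Formula α)) (w : M.World) :
    Sat M (bigAnd l) w ↔ ∀ A ∈ l, Sat M A w := by
  induction l with
  | nil => simp [bigAnd, Sat]
  | cons A l ih => simp [bigAnd, Sat, ih]

theorem sat_bigOr (M : ReflModel α) (l : List (Formula α)) (w : M.World) :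
    Sat M (bigOr l) w ↔ ∃ A ∈ l, Sat M A w := by
  induction l with
  | nil => simp [bigOr, Sat]
  | cons A l ih => simp [bigOr, Sat, ih]

theorem vars_bigAnd {l : List (Formula α)} {V : Finset ℕ} (h : ∀ A ∈ l, A.vars ⊆ V) :
    (bigAnd l).vars ⊆ V := by
  induction l with
  | nil => simp [bigAnd, vars]
  | cons A l ih =>
    simp only [List.mem_cons, forall_eq_or_imp] at h
    exact Finset.union_subset h.1 (ih h.2)

theorem vars_bigOr {l : List (Formula α)} {V : Finset ℕ} (h : ∀ A ∈ l, A.vars ⊆ V) :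
    (bigOr l).vars ⊆ V := by
  induction l with
  | nil => simp [bigOr, vars]
  | cons A l ih =>
    simp only [List.mem_cons, forall_eq_or_imp] at h
    exact Finset.union_subset h.1 (ih h.2)

open Classical in
/-- The formula saying that, among the formulas in `B`, exactly those in `S` are true. -/
noncomputable def describe (B S : Finset (Formula α)) : Formula α :=
  bigAnd (B.toList.map fun F => if F ∈ S then F else neg F)

theorem sat_describe (M : ReflModel α) (B S : Finset (Formula α)) (w : M.World) :
    Sat M (describe B S) w ↔ ∀ F ∈ B, (Sat M F w ↔ F ∈ S) := by
  simp only [describe, sat_bigAnd, List.mem_map, Finset.mem_toList,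
    forall_exists_index, and_imp, forall_apply_eq_imp_iff₂]
  refine forall₂_congr fun F _ => ?_
  split_ifs with h <;> simp [Sat, h]

theorem vars_describe {B S : Finset (Formula α)} {V : Finset ℕ}
    (h : ∀ F ∈ B, F.vars ⊆ V) : (describe B S).vars ⊆ V := by
  refine vars_bigAnd fun A hA => ?_
  obtain ⟨F, hF, rfl⟩ := List.mem_map.1 hA
  have := h F (Finset.mem_toList.1 hF)
  split_ifs
  · exact this
  · exact this

open Classical in
/-- Finitely many formulas of modal depth at most `k` over `V`, whose truth values at a world
determine its type up to `k` layers of bisimulation. -/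
noncomputable def basis [Fintype α] (V : Finset ℕ) : ℕ → Finset (Formula α)
  | 0 => V.image var
  | k + 1 => V.image var ∪ Finset.univ.biUnion fun i =>
      (basis V k).powerset.image fun S => box i (neg (describe (basis V k) S))

theorem vars_basis [Fintype α] {V : Finset ℕ} {k : ℕ} {F : Formula α}
    (hF : F ∈ basis V k) : F.vars ⊆ V := by
  classical
  induction k generalizing F with
  | zero =>
    obtain ⟨q, hq, rfl⟩ := Finset.mem_image.1 hF
    simpa [vars] using hq
  | succ k ih =>
    rcases Finset.mem_union.1 hF with hF | hF
    · obtain ⟨q, hq, rfl⟩ := Finset.mem_image.1 hF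
      simpa [vars] using hq
    · obtain ⟨i, -, hF⟩ := Finset.mem_biUnion.1 hF
      obtain ⟨S, -, rfl⟩ := Finset.mem_image.1 hF
      exact vars_describe fun F hF => ih hF

theorem var_mem_basis [Fintype α] {V : Finset ℕ} {q : ℕ} (hq : q ∈ V) (k : ℕ) :
    (var q : Formula α) ∈ basis V k := by
  cases k <;> simp [basis, hq]

/-- Worlds that agree on the depth-`k` basis over `V`. -/
def LayeredEquiv [Fintype α] (V : Finset ℕ) (N M : ReflModel α) (k : ℕ)
    (n : N.World) (m : M.World) : Prop :=
  ∀ F ∈ basis V k, (Sat N F n ↔ Sat M F m)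

theorem LayeredEquiv.symm [Fintype α] {V : Finset ℕ} {N M : ReflModel α} {k : ℕ}
    {n : N.World} {m : M.World} (h : LayeredEquiv V N M k n m) :
    LayeredEquiv V M N k m n :=
  fun F hF => (h F hF).symm

theorem LayeredEquiv.forth [Fintype α] {V : Finset ℕ} {N M : ReflModel α} {k : ℕ}
    {n n' : N.World} {m : M.World} (h : LayeredEquiv V N M (k + 1) n m) {i : α}
    (hn : N.rel i n n') : ∃ m', M.rel i m m' ∧ LayeredEquiv V N M k n' m' := by
  classical
  set S := (basis V k).filter fun F => Sat N F n' with hS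
  have hmem : box i (neg (describe (basis V k) S)) ∈ basis V (k + 1) :=
    Finset.mem_union_right _ (Finset.mem_biUnion.2 ⟨i, Finset.mem_univ i,
      Finset.mem_image_of_mem _ (Finset.mem_powerset.2 (Finset.filter_subset _ _))⟩)
  have hnot : ¬ Sat N (box i (neg (describe (basis V k) S))) n := fun hbox =>
    hbox n' hn ((sat_describe ..).2 fun F hF => by simp [hS, hF])
  rw [h _ hmem] at hnot
  simp only [Sat, not_forall, not_not] at hnot
  obtain ⟨m', hm, hs⟩ := hnot
  refine ⟨m', hm, fun F hF => ?_⟩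
  rw [(sat_describe ..).1 hs F hF]
  simp [hS, hF]

/-! ### Amalgamation -/

section Amalgam

variable [Fintype α] (P V : Finset ℕ) (N M : ReflModel α)

/-- Accessibility in the amalgam of two models. -/
inductive AmalgamRel : α → (N.World × M.World × ℕ) ⊕ M.World →
    (N.World × M.World × ℕ) ⊕ M.World → Prop
  | refl_pair (i : α) (x : N.World × M.World × ℕ) : AmalgamRel i (.inl x) (.inl x)
  | step (i : α) (n n' : N.World) (m m' : M.World) (k : ℕ) :
      N.rel i n n' → M.rel i m m' → LayeredEquiv V N M k n' m' →
      AmalgamRel i (.inl (n, m, k + 1)) (.inl (n', m', k))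
  | leave (i : α) (n : N.World) (m m' : M.World) :
      M.rel i m m' → AmalgamRel i (.inl (n, m, 0)) (.inr m')
  | right (i : α) (m m' : M.World) : M.rel i m m' → AmalgamRel i (.inr m) (.inr m')

/-- A model bisimilar to `M` apart from the variables in `P`, which follow `N` as long as
the layer counter is positive. -/
def amalgam : ReflModel α where
  World := (N.World × M.World × ℕ) ⊕ M.World
  rel := AmalgamRel V N M
  val
    | .inl (n, m, _), q => (q ∈ P ∧ N.val n q) ∨ (q ∉ P ∧ M.val m q)
    | .inr m, q => M.val m q
  rel_self
    | i, .inl x => .refl_pair i x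
    | i, .inr m => .right i m m (M.rel_self i m)

variable {P V N M}

theorem sat_amalgam_inr (A : Formula α) (m : M.World) :
    Sat (amalgam P V N M) A (.inr m) ↔ Sat M A m := by
  induction A generalizing m with
  | var p => rfl
  | bot => rfl
  | box i A ih =>
    refine ⟨fun h v hv => (ih v).1 (h _ (.right i m v hv)), fun h v hv => ?_⟩
    cases hv with
    | right _ v hv => exact (ih v).2 (h v hv)
  | _ => simp_all only [Sat]

theorem sat_amalgam_right {A : Formula α} (hA : ∀ q ∈ A.vars, q ∉ P) {k : ℕ}
    {n : N.World} {m : M.World} (h : LayeredEquiv V N M k n m) :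
    Sat (amalgam P V N M) A (.inl (n, m, k)) ↔ Sat M A m := by
  induction A generalizing n m k with
  | var p =>
    have : p ∉ P := hA p (by simp [vars])
    simp [Sat, amalgam, this]
  | bot => rfl
  | box i A ih =>
    refine ⟨fun hs m' hm => ?_, fun hs v hv => ?_⟩
    · cases k with
      | zero => exact (sat_amalgam_inr A m').1 (hs _ (.leave i n m m' hm))
      | succ k =>
        obtain ⟨n', hn, he⟩ := h.symm.forth hm
        exact (ih hA he.symm).1 (hs _ (.step i n n' m m' k hn hm he.symm))
    · cases hv with
      | refl_pair => exact (ih hA h).2 (hs m (M.rel_self i m))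
      | step _ n' _ m' k hn hm he => exact (ih hA he).2 (hs m' hm)
      | leave _ _ m' hm => exact (sat_amalgam_inr A m').2 (hs m' hm)
  | neg A ih => exact not_congr (ih hA h)
  | _ =>
    simp only [vars, Finset.mem_union] at hA
    simp_all only [Sat, true_or, or_true, implies_true, not_false_eq_true, forall_const]

theorem sat_amalgam_left {A : Formula α} (hA : ∀ q ∈ A.vars, q ∈ P ∨ q ∈ V) {k : ℕ}
    (hk : modalDepth A ≤ k) {n : N.World} {m : M.World} (h : LayeredEquiv V N M k n m) :
    Sat (amalgam P V N M) A (.inl (n, m, k)) ↔ Sat N A n := by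
  induction A generalizing n m k with
  | var p =>
    by_cases hp : p ∈ P
    · simp [Sat, amalgam, hp]
    · have hv := h _ (var_mem_basis ((hA p (by simp [vars])).resolve_left hp) k)
      simpa [Sat, amalgam, hp] using hv.symm
  | bot => rfl
  | box i A ih =>
    cases k with
    | zero => simp [modalDepth] at hk
    | succ k =>
      have hk' : modalDepth A ≤ k := Nat.le_of_succ_le_succ hk
      refine ⟨fun hs n' hn => ?_, fun hs v hv => ?_⟩
      · obtain ⟨m', hm, he⟩ := h.forth hn
        exact (ih hA hk' he).1 (hs _ (.step i n n' m m' k hn hm he))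
      · cases hv with
        | refl_pair => exact (ih hA (hk'.trans (Nat.le_succ k)) h).2 (hs n (N.rel_self i n))
        | step _ n' _ m' k hn hm he => exact (ih hA hk' he).2 (hs n' hn)
  | neg A ih => exact not_congr (ih hA hk h)
  | _ =>
    simp only [vars, Finset.mem_union] at hA
    simp only [modalDepth, max_le_iff] at hk
    simp_all only [Sat, true_or, or_true, implies_true, forall_const]

end Amalgam

/-! ### Uniform interpolation -/

theorem exists_uniform_interpolant [Fintype α] (P : Finset ℕ) (Γ Δ : Multiset (Formula α)) :
    ∃ I : Formula α, I.vars ⊆ (mVars Γ ∪ mVars Δ) \ P ∧ G false true (I ::ₘ Γ) Δ ∧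
      ∀ Pis Lb : Multiset (Formula α), (∀ q ∈ mVars Pis ∪ mVars Lb, q ∉ P) →
        G false true (Pis + Γ) (Δ + Lb) → G false true Pis (I ::ₘ Lb) := by
  classical
  obtain ⟨d, hd⟩ := exists_modalDepth_lt (Γ + Δ)
  set V := (mVars Γ ∪ mVars Δ) \ P with hV
  set B : Finset (Formula α) := basis V d
  have hvars : ∀ C ∈ Γ + Δ, ∀ q ∈ C.vars, q ∈ P ∨ q ∈ V := by
    intro C hC q hq
    rw [or_iff_not_imp_left]
    intro hP
    rw [hV, Finset.mem_sdiff, Finset.mem_union, mem_mVars, mem_mVars]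
    rcases Multiset.mem_add.1 hC with hC | hC
    · exact ⟨.inl ⟨C, hC, hq⟩, hP⟩
    · exact ⟨.inr ⟨C, hC, hq⟩, hP⟩
  refine ⟨bigOr ((B.powerset.filter fun S => Valid (describe B S ::ₘ Γ) Δ).toList.map
    (describe B)), vars_bigOr ?_, derivable_iff_valid.2 ?_, fun Pis Lb hP hG =>
      derivable_iff_valid.2 ?_⟩
  · intro A hA
    obtain ⟨S, -, rfl⟩ := List.mem_map.1 hA
    exact vars_describe fun F hF => vars_basis hF
  · intro M w h
    simp only [Multiset.mem_cons, forall_eq_or_imp, sat_bigOr] at h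
    obtain ⟨⟨A, hA, hs⟩, hΓ⟩ := h
    obtain ⟨S, hS, rfl⟩ := List.mem_map.1 hA
    refine (Finset.mem_filter.1 (Finset.mem_toList.1 hS)).2 M w ?_
    simpa using ⟨hs, hΓ⟩
  · intro M w hPis
    by_contra! hLb
    simp only [Multiset.mem_cons, forall_eq_or_imp, sat_bigOr, not_exists, not_and] at hLb
    obtain ⟨hI, hLb⟩ := hLb
    have hw : Sat M (describe B (B.filter fun F => Sat M F w)) w :=
      (sat_describe ..).2 fun F hF => by simp [hF]
    have hnv : ¬ Valid (describe B (B.filter fun F => Sat M F w) ::ₘ Γ) Δ := fun hv =>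
      hI _ (List.mem_map_of_mem (Finset.mem_toList.2 (Finset.mem_filter.2
        ⟨Finset.mem_powerset.2 (Finset.filter_subset _ _), hv⟩))) hw
    refine hnv fun N n hn => ?_
    by_contra! hΔ
    simp only [Multiset.mem_cons, forall_eq_or_imp] at hn
    have he : LayeredEquiv V N M d n w := fun F hF => by
      rw [(sat_describe ..).1 hn.1 F hF]
      simp [B, hF]
    obtain ⟨C, hC, hs⟩ := hG.valid (amalgam P V N M) (.inl (n, w, d)) fun C hC => by
      rcases Multiset.mem_add.1 hC with hC | hC
      · exact (sat_amalgam_right (fun q hq =>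
          hP q (Finset.mem_union_left _ (mem_mVars.2 ⟨C, hC, hq⟩))) he).2 (hPis C hC)
      · have hC' : C ∈ Γ + Δ := Multiset.mem_add.2 (.inl hC)
        exact (sat_amalgam_left (hvars C hC') (hd C hC').le he).2 (hn.2 C hC)
    rcases Multiset.mem_add.1 hC with hC | hC
    · have hC' : C ∈ Γ + Δ := Multiset.mem_add.2 (.inr hC)
      exact hΔ C hC ((sat_amalgam_left (hvars C hC') (hd C hC').le he).1 hs)
    · exact hLb C hC ((sat_amalgam_right (fun q hq =>
        hP q (Finset.mem_union_right _ (mem_mVars.2 ⟨C, hC, hq⟩))) he).1 hs)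

theorem exists_pre_interpolant [Fintype α] (rs : Finset ℕ) (B : Formula α) :
    ∃ I : Formula α, (∀ r ∈ rs, r ∉ I.vars) ∧ G false true {I} {B} ∧
      ∀ A : Formula α, (∀ r ∈ rs, r ∉ A.vars) → G false true {A} {B} →
        G false true {A} {I} := by
  obtain ⟨I, hI, h1, h2⟩ := exists_uniform_interpolant rs 0 {B}
  refine ⟨I, fun r hr hrI => (Finset.mem_sdiff.1 (hI hrI)).2 hr, h1, fun A hA hG =>
    h2 {A} 0 (fun q hq hr => hA q hr ?_) (by simpa using hG)⟩
  simpa [mVars] using hq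

theorem exists_post_interpolant [Fintype α] (ps : Finset ℕ) (A : Formula α) :
    ∃ I : Formula α, (∀ p ∈ ps, p ∉ I.vars) ∧ G false true {A} {I} ∧
      ∀ B : Formula α, (∀ p ∈ ps, p ∉ B.vars) → G false true {A} {B} →
        G false true {I} {B} := by
  obtain ⟨I, hI, h1, h2⟩ := exists_uniform_interpolant ps {A} 0
  refine ⟨neg I, fun r hr hrI => (Finset.mem_sdiff.1 (hI hrI)).2 hr, .negR h1,
    fun B hB hG => .negL (h2 0 {B} (fun q hq hr => hB q hr ?_) (by simpa using hG))⟩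
  simpa [mVars] using hq

end UIP

/-- `KT_n` has uniform interpolation: a constructor `A_p(Γ; Δ)`
with properties (i)-(iii) for `G(KT_n)`, and consequently pre- and
post-interpolants for any finite set of variables. -/
theorem KTn_uniform_interpolation {α : Type} [Fintype α] :
    (∃ Ap : ℕ → Multiset (Formula α) → Multiset (Formula α) → Formula α,
      ∀ (p : ℕ) (Γ Δ : Multiset (Formula α)),
        (Ap p Γ Δ).vars ⊆ (mVars Γ ∪ mVars Δ).erase p ∧
        G false true (Ap p Γ Δ ::ₘ Γ) Δ ∧
        ∀ Pis Lb : Multiset (Formula α),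
          p ∉ mVars Pis ∪ mVars Lb → G false true (Pis + Γ) (Δ + Lb) →
          G false true Pis (Ap p Γ Δ ::ₘ Lb)) ∧
    (∀ (rs : Finset ℕ) (B : Formula α), ∃ I : Formula α,
      (∀ r ∈ rs, r ∉ I.vars) ∧ G false true {I} {B} ∧
      ∀ A : Formula α, (∀ r ∈ rs, r ∉ A.vars) → G false true {A} {B} →
        G false true {A} {I}) ∧
    (∀ (ps : Finset ℕ) (A : Formula α), ∃ I : Formula α,
      (∀ p ∈ ps, p ∉ I.vars) ∧ G false true {A} {I} ∧
      ∀ B : Formula α, (∀ p ∈ ps, p ∉ B.vars) → G false true {A} {B} →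
        G false true {I} {B}) := by
  refine ⟨?_, exists_pre_interpolant, exists_post_interpolant⟩
  choose Ap hvars hL hR using fun p : ℕ => exists_uniform_interpolant (α := α) {p}
  refine ⟨Ap, fun p Γ Δ => ⟨?_, hL p Γ Δ, fun Pis Lb hp => hR p Γ Δ Pis Lb ?_⟩⟩
  · rw [← Finset.sdiff_singleton_eq_erase]
    exact hvars p Γ Δ
  · rintro q hq hqp
    exact hp (Finset.mem_singleton.1 hqp ▸ hq)
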